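/- Let b = (b_1, …, b_d) ∈ ℤ^d be an integer point and let I ∪ J be a partition of {1, …, d} with |I| ≥ |J| > 0 such that b_i ≤ 2^{d-2} for every i ∈ I and b_j > 2^{d-2} for every j ∈ J. If b − (d+1)^2·(Σ_{i∈I} e_i − Σ_{j∈J} e_j) ∈ Z^d, then b ∈ S. -/

import Mathlib

open Finset

/-- The 0/1 vector in `ℝ^n` corresponding to a Boolean vector. -/
noncomputable def toVec {n : ℕ} (v : Fin n → Bool) : Fin n → ℝ :=
  fun i => if v i then 1 else 0

/-- The set `S` of degree sequences of hypergraphs on `n` vertices: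
sums of sets of pairwise distinct 0/1 vectors. -/
def degSeqs (n : ℕ) : Set (Fin n → ℝ) :=
  {b | ∃ U : Finset (Fin n → Bool), b = ∑ v ∈ U, toVec v}

/-- The degree-sequence polytope `Z^n`. -/
def dsPolytope (n : ℕ) : Set (Fin n → ℝ) :=
  {p | ∃ c : (Fin n → Bool) → ℝ, (∀ v, 0 ≤ c v ∧ c v ≤ 1) ∧
    p = ∑ v : Fin n → Bool, c v • toVec v}

/-- Degree of vertex `k` in `U`. -/
def dg {d : ℕ} (U : Finset (Fin d → Bool)) (k : Fin d) : ℤ :=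
  ∑ v ∈ U, if v k then 1 else 0

lemma dg_swap {d : ℕ} (U : Finset (Fin d → Bool)) {v w : Fin d → Bool} (hv : v ∈ U) (hw : w ∉ U)
    (k : Fin d) :
    dg (insert w (U.erase v)) k = dg U k - (if v k then 1 else 0) + (if w k then 1 else 0) := by
  unfold dg
  rw [Finset.sum_insert (fun h => hw (Finset.mem_of_mem_erase h))]
  rw [← Finset.add_sum_erase U _ hv]
  ring

lemma card_swap {d : ℕ} (U : Finset (Fin d → Bool)) {v w : Fin d → Bool} (hv : v ∈ U)
    (hw : w ∉ U) : (insert w (U.erase v)).card = U.card := by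
  rw [Finset.card_insert_of_notMem (fun h => hw (Finset.mem_of_mem_erase h)),
    Finset.card_erase_of_mem hv]
  have := Finset.card_pos.2 ⟨v, hv⟩
  omega

/-- If an involution `φ` never leads from `A ∩ U` out of `U`, weights do not grow. -/
lemma exists_move {d : ℕ} (U : Finset (Fin d → Bool)) (φ : (Fin d → Bool) → (Fin d → Bool))
    (hφ : Function.Involutive φ) (P Q : (Fin d → Bool) → Prop) [DecidablePred P] [DecidablePred Q]
    (hPQ : ∀ v, P v → Q (φ v))
    (hlt : (U.filter Q).card < (U.filter P).card) : ∃ v ∈ U, P v ∧ φ v ∉ U := by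
  by_contra! h
  refine absurd hlt (not_lt.2 ?_)
  refine Finset.card_le_card_of_injOn φ ?_ hφ.injective.injOn
  intro v hv
  have hv' := Finset.mem_filter.1 (Finset.mem_coe.1 hv)
  exact Finset.mem_coe.2 (Finset.mem_filter.2 ⟨h v hv'.1 hv'.2, hPQ v hv'.2⟩)

lemma dg_eq {d : ℕ} (U : Finset (Fin d → Bool)) (k : Fin d) :
    dg U k = (U.filter (fun v => v k = true)).card := by
  unfold dg
  rw [Finset.sum_boole]

lemma pair_move {d : ℕ} (U : Finset (Fin d → Bool)) (i j : Fin d) (h : dg U i < dg U j) :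
    ∃ U' : Finset (Fin d → Bool), U'.card = U.card ∧ dg U' i = dg U i + 1 ∧
      dg U' j = dg U j - 1 ∧ ∀ k, k ≠ i → k ≠ j → dg U' k = dg U k := by
  have hij : i ≠ j := by rintro rfl; exact lt_irrefl _ h
  obtain ⟨v, hv, hP, hw⟩ := exists_move U (fun v => v ∘ Equiv.swap i j)
    (by intro v; ext k; simp) (fun v => v j = true ∧ v i = false)
    (fun v => v i = true ∧ v j = false) (by intro v; simp) (by
      have h1 : dg U i = (U.filter (fun v => v i = true ∧ v j = false)).card
          + (U.filter (fun v => v i = true ∧ v j = true)).card := by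
        rw [dg_eq, ← Finset.card_filter_add_card_filter_not (s := U.filter (fun v => v i = true))
          (fun v => v j = false)]
        simp [Finset.filter_filter]
      have h2 : dg U j = (U.filter (fun v => v j = true ∧ v i = false)).card
          + (U.filter (fun v => v i = true ∧ v j = true)).card := by
        rw [dg_eq, ← Finset.card_filter_add_card_filter_not (s := U.filter (fun v => v j = true))
          (fun v => v i = false)]
        simp [Finset.filter_filter, and_comm]
      omega)
  refine ⟨insert (v ∘ Equiv.swap i j) (U.erase v), card_swap U hv hw, ?_, ?_, ?_⟩
  · rw [dg_swap U hv hw]; simp [hP]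
  · rw [dg_swap U hv hw]; simp [hP]
  · intro k hi hj
    rw [dg_swap U hv hw]; simp [Equiv.swap_apply_of_ne_of_ne hi hj]

lemma dg_compl {d : ℕ} (U : Finset (Fin d → Bool)) (k : Fin d) :
    (U.card : ℤ) - dg U k = (U.filter (fun v => v k = false)).card := by
  rw [dg_eq, ← Finset.card_filter_add_card_filter_not (s := U) (fun v => v k = true)]
  simp

lemma flip_invol {d : ℕ} (i : Fin d) :
    Function.Involutive (fun v : Fin d → Bool => Function.update v i (!v i)) := by
  intro v; ext k; by_cases hk : k = i
  · subst hk; simp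
  · simp [hk]

lemma raise_move {d : ℕ} (U : Finset (Fin d → Bool)) (i : Fin d) (h : 2 * dg U i < U.card) :
    ∃ U' : Finset (Fin d → Bool), U'.card = U.card ∧ dg U' i = dg U i + 1 ∧
      ∀ k, k ≠ i → dg U' k = dg U k := by
  obtain ⟨v, hv, hP, hw⟩ := exists_move U _ (flip_invol i) (fun v => v i = false)
    (fun v => v i = true) (by intro v; simp) (by
      have h1 := dg_eq U i
      have h2 := dg_compl U i
      omega)
  refine ⟨insert _ (U.erase v), card_swap U hv hw, ?_, ?_⟩
  · rw [dg_swap U hv hw]; simp [hP]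
  · intro k hi
    rw [dg_swap U hv hw]; simp [hi]

lemma lower_move {d : ℕ} (U : Finset (Fin d → Bool)) (i : Fin d) (h : (U.card : ℤ) < 2 * dg U i) :
    ∃ U' : Finset (Fin d → Bool), U'.card = U.card ∧ dg U' i = dg U i - 1 ∧
      ∀ k, k ≠ i → dg U' k = dg U k := by
  obtain ⟨v, hv, hP, hw⟩ := exists_move U _ (flip_invol i) (fun v => v i = true)
    (fun v => v i = false) (by intro v; simp) (by
      have h1 := dg_eq U i
      have h2 := dg_compl U i
      omega)
  refine ⟨insert _ (U.erase v), card_swap U hv hw, ?_, ?_⟩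
  · rw [dg_swap U hv hw]; simp [hP]
  · intro k hi
    rw [dg_swap U hv hw]; simp [hi]

lemma sum_upd {d : ℕ} (I : Finset (Fin d)) (f g : Fin d → ℤ) (i : Fin d) (hi : i ∈ I) (a : ℤ)
    (h1 : g i = f i + a) (h2 : ∀ k ∈ I, k ≠ i → g k = f k) :
    ∑ k ∈ I, g k = ∑ k ∈ I, f k + a := by
  rw [← Finset.add_sum_erase I g hi, ← Finset.add_sum_erase I f hi, h1,
    Finset.sum_congr rfl (fun k hk => h2 k (Finset.mem_of_mem_erase hk) (Finset.ne_of_mem_erase hk))]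
  ring

/-- The discrete finishing lemma. -/
lemma finish {d : ℕ} (b : Fin d → ℤ) (I J : Finset (Fin d)) (H : ℤ)
    (hdisj : Disjoint I J) (hunion : I ∪ J = Finset.univ)
    (hI : ∀ i ∈ I, b i ≤ H) (hJ : ∀ j ∈ J, H < b j) (n : ℕ) :
    ∀ (U : Finset (Fin d → Bool)),
    (∑ i ∈ I, (b i - dg U i) + ∑ j ∈ J, (dg U j - b j) = n) →
    (∀ i ∈ I, dg U i ≤ b i) → (∀ j ∈ J, b j ≤ dg U j) →
    (∑ i ∈ I, (b i - dg U i) ≤ ∑ j ∈ J, (dg U j - b j) ∨ 2 * H ≤ U.card) →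
    (∑ j ∈ J, (dg U j - b j) ≤ ∑ i ∈ I, (b i - dg U i) ∨ (U.card : ℤ) ≤ 2 * H) →
    ∃ U' : Finset (Fin d → Bool), ∀ k, dg U' k = b k := by
  induction n using Nat.strong_induction_on with
  | _ n ih =>
  intro U hn hUI hUJ h1 h2
  have nI : 0 ≤ ∑ i ∈ I, (b i - dg U i) :=
    Finset.sum_nonneg (fun i hi => sub_nonneg.2 (hUI i hi))
  have nJ : 0 ≤ ∑ j ∈ J, (dg U j - b j) :=
    Finset.sum_nonneg (fun i hi => sub_nonneg.2 (hUJ i hi))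
  have exI : 0 < ∑ i ∈ I, (b i - dg U i) → ∃ i ∈ I, dg U i < b i := by
    intro h
    obtain ⟨i, hi, h⟩ := Finset.exists_lt_of_sum_lt (s := I) (f := fun _ => (0:ℤ))
      (g := fun i => b i - dg U i) (by rw [Finset.sum_const_zero]; exact h)
    exact ⟨i, hi, by omega⟩
  have exJ : 0 < ∑ j ∈ J, (dg U j - b j) → ∃ j ∈ J, b j < dg U j := by
    intro h
    obtain ⟨i, hi, h⟩ := Finset.exists_lt_of_sum_lt (s := J) (f := fun _ => (0:ℤ))
      (g := fun j => dg U j - b j) (by rw [Finset.sum_const_zero]; exact h)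
    exact ⟨i, hi, by omega⟩
  have hne : ∀ i ∈ I, ∀ j ∈ J, i ≠ j := fun i hi j hj h =>
    Finset.disjoint_left.1 hdisj hi (h ▸ hj)
  by_cases zI : 0 < ∑ i ∈ I, (b i - dg U i)
  · obtain ⟨i, hi, hib⟩ := exI zI
    by_cases zJ : 0 < ∑ j ∈ J, (dg U j - b j)
    · obtain ⟨j, hj, hjb⟩ := exJ zJ
      clear exI exJ
      obtain ⟨U', c', di, dj, dk⟩ := pair_move U i j (by have := hI i hi; have := hJ j hj; omega)
      have sI := sum_upd I (fun k => b k - dg U k) (fun k => b k - dg U' k) i hi (-1)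
        (by simp only [di]; ring) (fun k hk hki => by simp only [dk k hki (hne k hk j hj)])
      have sJ := sum_upd J (fun k => dg U k - b k) (fun k => dg U' k - b k) j hj (-1)
        (by simp only [dj]; ring) (fun k hk hki => by simp only [dk k (hne i hi k hk).symm hki])
      refine ih (n - 2) (by omega) U' (by omega) ?_ ?_ (by omega) (by omega)
      · intro k hk
        by_cases hki : k = i
        · subst hki; omega
        · rw [dk k hki (hne k hk j hj)]; exact hUI k hk
      · intro k hk
        by_cases hkj : k = j
        · subst hkj; omega
        · rw [dk k (hne i hi k hk).symm hkj]; exact hUJ k hk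
    · clear exI exJ
      obtain ⟨U', c', di, dk⟩ := raise_move U i (by have := hI i hi; omega)
      have sI := sum_upd I (fun k => b k - dg U k) (fun k => b k - dg U' k) i hi (-1)
        (by simp only [di]; ring) (fun k hk hki => by simp only [dk k hki])
      have sJ : ∑ j ∈ J, (dg U' j - b j) = ∑ j ∈ J, (dg U j - b j) :=
        Finset.sum_congr rfl (fun k hk => by rw [dk k (hne i hi k hk).symm])
      refine ih (n - 1) (by omega) U' (by omega) ?_ ?_ (by omega) (by omega)
      · intro k hk
        by_cases hki : k = i
        · subst hki; omega
        · rw [dk k hki]; exact hUI k hk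
      · intro k hk
        rw [dk k (hne i hi k hk).symm]; exact hUJ k hk
  · by_cases zJ : 0 < ∑ j ∈ J, (dg U j - b j)
    · obtain ⟨j, hj, hjb⟩ := exJ zJ
      clear exI exJ
      obtain ⟨U', c', dj, dk⟩ := lower_move U j (by have := hJ j hj; omega)
      have sI : ∑ i ∈ I, (b i - dg U' i) = ∑ i ∈ I, (b i - dg U i) :=
        Finset.sum_congr rfl (fun k hk => by rw [dk k (hne k hk j hj)])
      have sJ := sum_upd J (fun k => dg U k - b k) (fun k => dg U' k - b k) j hj (-1)
        (by simp only [dj]; ring) (fun k hk hki => by simp only [dk k hki])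
      refine ih (n - 1) (by omega) U' (by omega) ?_ ?_ (by omega) (by omega)
      · intro k hk
        rw [dk k (hne k hk j hj)]; exact hUI k hk
      · intro k hk
        by_cases hkj : k = j
        · subst hkj; omega
        · rw [dk k hkj]; exact hUJ k hk
    · refine ⟨U, fun k => ?_⟩
      have hk : k ∈ I ∪ J := by rw [hunion]; exact Finset.mem_univ k
      rcases Finset.mem_union.1 hk with hk | hk
      · have := (Finset.sum_eq_zero_iff_of_nonneg
          (fun i hi => sub_nonneg.2 (hUI i hi))).1 (le_antisymm (not_lt.1 zI) nI) k hk
        omega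
      · have := (Finset.sum_eq_zero_iff_of_nonneg
          (fun i hi => sub_nonneg.2 (hUJ i hi))).1 (le_antisymm (not_lt.1 zJ) nJ) k hk
        omega

/-- One step of reducing the number of fractional coordinates. -/
lemma frac_step {V : Type*} [Fintype V] [DecidableEq V] (c g : V → ℝ)
    (hc : ∀ v, 0 ≤ c v ∧ c v ≤ 1) (hg : ∀ v, g v ≠ 0 → 0 < c v ∧ c v < 1) (hg0 : g ≠ 0) :
    ∃ t : ℝ, (∀ v, 0 ≤ c v + t * g v ∧ c v + t * g v ≤ 1) ∧
      (Finset.univ.filter (fun v => 0 < c v + t * g v ∧ c v + t * g v < 1)).card <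
      (Finset.univ.filter (fun v => 0 < c v ∧ c v < 1)).card := by
  obtain ⟨v1, hv1⟩ := Function.ne_iff.1 hg0
  let r : V → ℝ := fun v => if 0 < g v then (1 - c v) / g v else c v / (- g v)
  obtain ⟨v0, hv0, hmin⟩ := Finset.exists_min_image (Finset.univ.filter (fun v => g v ≠ 0)) r
    ⟨v1, by simpa using hv1⟩
  have hv0 : g v0 ≠ 0 := by simpa using hv0
  have hr0 : 0 ≤ r v0 := by
    have := hg v0 hv0
    simp only [r]; split_ifs with h
    · exact div_nonneg (by linarith) h.le
    · exact div_nonneg (by linarith) (by linarith)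
  have key : ∀ v, 0 ≤ c v + r v0 * g v ∧ c v + r v0 * g v ≤ 1 := by
    intro v
    have h0 := hc v
    rcases lt_trichotomy (g v) 0 with h | h | h
    · have h2 := hmin v (by simpa using h.ne)
      have h3 : r v = c v / (- g v) := if_neg (by linarith)
      rw [h3, le_div_iff₀ (by linarith)] at h2
      constructor
      · linarith
      · nlinarith
    · simpa [h] using h0
    · have h2 := hmin v (by simpa using h.ne')
      have h3 : r v = (1 - c v) / g v := if_pos h
      rw [h3, le_div_iff₀ h] at h2
      constructor
      · nlinarith
      · linarith
  refine ⟨r v0, key, Finset.card_lt_card ?_⟩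
  rw [Finset.ssubset_iff_of_subset]
  · refine ⟨v0, by simpa using hg v0 hv0, ?_⟩
    simp only [Finset.mem_filter, Finset.mem_univ, true_and, not_and, not_lt]
    rcases lt_or_gt_of_ne hv0 with h | h
    · have h3 : r v0 = c v0 / (- g v0) := if_neg (by linarith)
      have : r v0 * g v0 = - c v0 := by rw [h3]; field_simp
      intro h4; linarith
    · have h3 : r v0 = (1 - c v0) / g v0 := if_pos h
      have : r v0 * g v0 = 1 - c v0 := by rw [h3]; field_simp
      intro _; linarith
  · intro v hv
    by_cases h : g v = 0
    · simpa [h] using hv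
    · simpa using hg v h

lemma few_frac {V W : Type*} [Fintype V] [DecidableEq V] [AddCommGroup W] [Module ℝ W]
    [FiniteDimensional ℝ W] (L : (V → ℝ) →ₗ[ℝ] W) (n : ℕ) :
    ∀ c : V → ℝ, (∀ v, 0 ≤ c v ∧ c v ≤ 1) →
    (Finset.univ.filter (fun v => 0 < c v ∧ c v < 1)).card = n →
    ∃ c' : V → ℝ, (∀ v, 0 ≤ c' v ∧ c' v ≤ 1) ∧ L c' = L c ∧
      (Finset.univ.filter (fun v => 0 < c' v ∧ c' v < 1)).card ≤ Module.finrank ℝ W := by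
  induction n using Nat.strong_induction_on with
  | _ n ih =>
  intro c hc hn
  by_cases hle : n ≤ Module.finrank ℝ W
  · exact ⟨c, hc, rfl, hn ▸ hle⟩
  push Not at hle
  let F := Finset.univ.filter (fun v => 0 < c v ∧ c v < 1)
  let E : (F → ℝ) →ₗ[ℝ] (V → ℝ) := Function.ExtendByZero.linearMap ℝ (Subtype.val : F → V)
  have hker : LinearMap.ker (L ∘ₗ E) ≠ ⊥ := by
    apply LinearMap.ker_ne_bot_of_finrank_lt
    rw [Module.finrank_fintype_fun_eq_card, Fintype.card_coe]
    exact hn ▸ hle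
  obtain ⟨x, hx, hx0⟩ := Submodule.exists_mem_ne_zero_of_ne_bot hker
  have hEx : ∀ v : F, E x v = x v := fun v => 
    Subtype.val_injective.extend_apply x (0 : V → ℝ) v
  obtain ⟨t, ht, hlt⟩ := frac_step c (E x) hc (by
    intro v hv
    by_contra hcon
    apply hv
    refine Function.extend_apply' x (0 : V → ℝ) v ?_
    rintro ⟨a, rfl⟩
    exact hcon (Finset.mem_filter.1 a.2).2) (by
    intro h
    apply hx0
    ext v
    rw [← hEx v, h]; rfl)
  obtain ⟨c', h1, h2, h3⟩ := ih _ (hn ▸ hlt) (fun v => c v + t * E x v) ht rfl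
  refine ⟨c', h1, ?_, h3⟩
  rw [h2]
  have : (fun v => c v + t * E x v) = c + t • E x := by ext v; simp
  rw [this, map_add, map_smul]
  have : L (E x) = 0 := hx
  simp [this]

lemma rounding {d : ℕ} (c : (Fin d → Bool) → ℝ) (hc : ∀ v, 0 ≤ c v ∧ c v ≤ 1) :
    ∃ U : Finset (Fin d → Bool), U.card = ⌊∑ v, c v⌋₊ ∧
      ∀ k, |(dg U k : ℝ) - ∑ v, c v * toVec v k| ≤ d + 1 := by
  let L : ((Fin d → Bool) → ℝ) →ₗ[ℝ] ((Fin d → ℝ) × ℝ) :=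
    { toFun := fun c => (fun k => ∑ v, c v * toVec v k, ∑ v, c v)
      map_add' := by
        intro x y
        ext
        · simp [add_mul, Finset.sum_add_distrib]
        · simp [Finset.sum_add_distrib]
      map_smul' := by
        intro x y
        ext
        · simp [Finset.mul_sum, mul_assoc]
        · simp [Finset.mul_sum] }
  obtain ⟨e, he, hL, hF⟩ := few_frac L _ c hc rfl
  have hfin : Module.finrank ℝ ((Fin d → ℝ) × ℝ) = d + 1 := by simp
  rw [hfin] at hF
  have hs : ∑ v, e v = ∑ v, c v := congrArg Prod.snd hL
  have hk : ∀ k, ∑ v, e v * toVec v k = ∑ v, c v * toVec v k :=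
    fun k => congrFun (congrArg Prod.fst hL) k
  set F := Finset.univ.filter (fun v => 0 < e v ∧ e v < 1) with hFdef
  let O := Finset.univ.filter (fun v => e v = 1)
  have hOF : O ⊆ O ∪ F := Finset.subset_union_left
  have hlow : O.card ≤ ⌊∑ v, c v⌋₊ := by
    apply Nat.le_floor
    rw [← hs]
    calc (O.card : ℝ) = ∑ v ∈ O, e v := by
          rw [Finset.sum_congr rfl (fun v hv => (Finset.mem_filter.1 hv).2)]; simp [O]
      _ ≤ _ := Finset.sum_le_sum_of_subset_of_nonneg (Finset.subset_univ _) (fun v _ _ => (he v).1)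
  have hup : ⌊∑ v, c v⌋₊ ≤ (O ∪ F).card := by
    apply Nat.floor_le_of_le
    rw [← hs]
    have : ∑ v, e v = ∑ v ∈ O ∪ F, e v := by
      symm
      apply Finset.sum_subset (Finset.subset_univ _)
      intro v _ hv
      simp only [O, hFdef, Finset.mem_union, Finset.mem_filter, Finset.mem_univ, true_and,
        not_or, not_and] at hv
      by_contra h
      have h0 := lt_of_le_of_ne (he v).1 (Ne.symm h)
      exact hv.2 h0 (lt_of_le_of_ne (he v).2 hv.1)
    rw [this]
    calc ∑ v ∈ O ∪ F, e v ≤ ∑ v ∈ O ∪ F, (1:ℝ) := Finset.sum_le_sum (fun v _ => (he v).2)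
      _ = _ := by simp
  obtain ⟨U, hOU, hUF, hU⟩ := Finset.exists_subsuperset_card_eq hOF hlow hup
  refine ⟨U, hU, fun k => ?_⟩
  rw [← hk]
  have hdg : (dg U k : ℝ) = ∑ v, (if v ∈ U then 1 else 0) * toVec v k := by
    simp only [ite_mul, one_mul, zero_mul, Finset.sum_ite_mem, Finset.univ_inter]
    simp [dg, toVec]
  rw [hdg, ← Finset.sum_sub_distrib]
  have hb : ∀ v, |(if v ∈ U then 1 else 0) * toVec v k - e v * toVec v k|
      ≤ if v ∈ F then (1:ℝ) else 0 := by
    intro v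
    rw [← sub_mul, abs_mul]
    have ht : |toVec v k| ≤ 1 := by unfold toVec; split_ifs <;> simp
    have ht0 := abs_nonneg (toVec v k)
    by_cases hv : v ∈ F
    · rw [if_pos hv]
      have : |(if v ∈ U then (1:ℝ) else 0) - e v| ≤ 1 := by
        have := he v
        rw [abs_le]; split_ifs <;> constructor <;> linarith
      exact mul_le_one₀ this ht0 ht
    · rw [if_neg hv]
      have : (if v ∈ U then (1:ℝ) else 0) - e v = 0 := by
        by_cases h1 : e v = 1
        · rw [if_pos (hOU (by simp [O, h1])), h1, sub_self]
        · have hvU : v ∉ U := by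
            intro h
            rcases Finset.mem_union.1 (hUF h) with h | h
            · exact h1 (Finset.mem_filter.1 h).2
            · exact hv h
          rw [if_neg hvU]
          by_contra h0
          apply hv
          have h0 : e v ≠ 0 := fun h => h0 (by simp [h])
          simp only [hFdef, Finset.mem_filter, Finset.mem_univ, true_and]
          exact ⟨lt_of_le_of_ne (he v).1 (Ne.symm h0), lt_of_le_of_ne (he v).2 h1⟩
      rw [this]; simp
  calc _ ≤ ∑ v, |(if v ∈ U then 1 else 0) * toVec v k - e v * toVec v k| :=
        Finset.abs_sum_le_sum_abs _ _
    _ ≤ ∑ v, if v ∈ F then (1:ℝ) else 0 := Finset.sum_le_sum (fun v _ => hb v)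
    _ = F.card := by simp
    _ ≤ d + 1 := by exact_mod_cast hF

/-- Mixing with the complementary reflection shifts all degrees by the same amount. -/
lemma shift {d : ℕ} (c : (Fin d → Bool) → ℝ) (hc : ∀ v, 0 ≤ c v ∧ c v ≤ 1) (N : ℝ)
    (hN : ∀ k : Fin d, ∑ v, toVec v k = N) (hN2 : ((2:ℝ) ^ d) = 2 * N) (t : ℝ) (ht0 : 0 ≤ t)
    (ht1 : t ≤ 1) :
    ∃ e : (Fin d → Bool) → ℝ, (∀ v, 0 ≤ e v ∧ e v ≤ 1) ∧
      (∑ v, e v = ∑ v, c v + 2 * t * (N - ∑ v, c v)) ∧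
      ∀ k, ∑ v, e v * toVec v k = ∑ v, c v * toVec v k + t * (N - ∑ v, c v) := by
  let φ : (Fin d → Bool) → (Fin d → Bool) := fun v k => !v k
  have hφ : Function.Involutive φ := by intro v; ext k; simp [φ]
  have hsum : ∀ f : (Fin d → Bool) → ℝ, ∑ v, f (φ v) = ∑ v, f v := fun f =>
    Equiv.sum_comp hφ.toPerm f
  refine ⟨fun v => (1 - t) * c v + t * (1 - c (φ v)), ?_, ?_, ?_⟩
  · intro v
    have := hc v
    have := hc (φ v)
    constructor <;> nlinarith
  · rw [Finset.sum_add_distrib, ← Finset.mul_sum, ← Finset.mul_sum, Finset.sum_sub_distrib, hsum]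
    simp only [Finset.sum_const, Finset.card_univ, nsmul_eq_mul, mul_one, Fintype.card_pi,
      Fintype.card_bool, Finset.prod_const, Fintype.card_fin]
    push_cast
    rw [hN2]; ring
  · intro k
    have h1 : ∑ v, c (φ v) * toVec v k = ∑ v, c v - ∑ v, c v * toVec v k := by
      rw [← hsum (fun v => c (φ v) * toVec v k), ← Finset.sum_sub_distrib]
      refine Finset.sum_congr rfl fun v _ => ?_
      rw [hφ v]
      cases h : v k <;> simp [toVec, φ, h]
    have h2 : ∀ v : Fin d → Bool, ((1 - t) * c v + t * (1 - c (φ v))) * toVec v k =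
      (1 - t) * (c v * toVec v k) + t * (toVec v k - c (φ v) * toVec v k) := fun v => by ring
    simp only [h2]
    rw [Finset.sum_add_distrib, ← Finset.mul_sum, ← Finset.mul_sum, Finset.sum_sub_distrib, h1, hN]
    ring

lemma sum_toVec {d : ℕ} (k : Fin d) (N : ℝ) (hN2 : ((2:ℝ) ^ d) = 2 * N) :
    ∑ v, toVec v k = N := by
  let φ : (Fin d → Bool) → (Fin d → Bool) := fun v k => !v k
  have hφ : Function.Involutive φ := by intro v; ext k; simp [φ]
  have hsum : ∑ v, toVec (φ v) k = ∑ v, toVec v k := Equiv.sum_comp hφ.toPerm (fun v => toVec v k)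
  have h : ∑ v, (toVec (φ v) k + toVec v k) = ∑ v : Fin d → Bool, (1:ℝ) := by
    refine Finset.sum_congr rfl fun v _ => ?_
    cases h : v k <;> simp [toVec, φ, h]
  rw [Finset.sum_add_distrib, hsum] at h
  simp only [Finset.sum_const, Finset.card_univ, nsmul_eq_mul, mul_one, Fintype.card_pi,
      Fintype.card_bool, Finset.prod_const, Fintype.card_fin] at h
  push_cast at h
  linarith

/-- Choice of the mixing parameter. -/
lemma clamp (s N K : ℝ) (hK : 0 ≤ K) : ∃ t : ℝ, 0 ≤ t ∧ t ≤ 1 ∧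
    |t * (N - s)| ≤ K ∧
    (s + 2 * t * (N - s) = N ∨ (t * (N - s) = K ∧ s + 2 * t * (N - s) ≤ N) ∨
      (t * (N - s) = -K ∧ N ≤ s + 2 * t * (N - s))) := by
  by_cases h : |N - s| ≤ 2 * K
  · refine ⟨1/2, by norm_num, by norm_num, ?_, Or.inl (by ring)⟩
    rw [abs_mul, abs_of_pos (by norm_num : (0:ℝ) < 1/2)]
    linarith
  · push Not at h
    have hpos : 0 < |N - s| := by linarith
    refine ⟨K / |N - s|, by positivity, ?_, ?_, Or.inr ?_⟩
    · rw [div_le_one hpos]; linarith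
    · rw [abs_mul, abs_div, abs_abs, div_mul_cancel₀ _ hpos.ne', abs_of_nonneg hK]
    · rcases abs_cases (N - s) with ⟨h1, _⟩ | ⟨h1, _⟩
      · left
        have : K / |N - s| * (N - s) = K := by rw [h1] at hpos ⊢; field_simp
        refine ⟨this, ?_⟩
        rw [mul_assoc, this]; linarith
      · right
        have h3 : N - s ≠ 0 := fun h => by rw [h] at hpos; simp at hpos
        have : K / |N - s| * (N - s) = -K := by rw [h1]; field_simp
        refine ⟨this, ?_⟩
        rw [mul_assoc, this]; linarith

/-- Theorem (main3): if `I ∪ J` partitions the coordinates with `|I| ≥ |J| > 0`,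
`bᵢ ≤ 2^(d-2)` on `I`, `bⱼ > 2^(d-2)` on `J`, and
`b - (d+1)²(∑_{i∈I} eᵢ - ∑_{j∈J} eⱼ) ∈ Z^d`, then `b ∈ S`. -/
theorem theorem_main3 (d : ℕ) (b : Fin d → ℤ) (I J : Finset (Fin d))
    (hdisj : Disjoint I J) (hunion : I ∪ J = Finset.univ)
    (hcard : J.card ≤ I.card) (hJ : 0 < J.card)
    (hI : ∀ i ∈ I, b i ≤ 2 ^ (d - 2))
    (hJub : ∀ j ∈ J, 2 ^ (d - 2) < b j)
    (hZ : (fun k => (b k : ℝ) - ((d : ℝ) + 1) ^ 2 * (if k ∈ I then 1 else -1))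
        ∈ dsPolytope d) :
    (fun i => (b i : ℝ)) ∈ degSeqs d := by
  have hIJ : I.card + J.card = d := by
    rw [← Finset.card_union_of_disjoint hdisj, hunion]; simp
  have hd2 : 2 ≤ d := by omega
  obtain ⟨c, hc, hp⟩ := hZ
  have hp' : ∀ k, ∑ v, c v * toVec v k =
      (b k : ℝ) - ((d : ℝ) + 1) ^ 2 * (if k ∈ I then 1 else -1) := by
    intro k
    have := congrFun hp k
    simp only [Finset.sum_apply, Pi.smul_apply, smul_eq_mul] at this
    exact this.symm
  set H : ℕ := 2 ^ (d - 2) with hH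
  have hN2 : ((2:ℝ) ^ d) = 2 * ((2 * H : ℕ) : ℝ) := by
    obtain ⟨m, rfl⟩ := Nat.exists_eq_add_of_le hd2
    simp only [hH, Nat.add_sub_cancel_left]
    push_cast
    ring
  have hdR : (2:ℝ) ≤ d := by exact_mod_cast hd2
  set D : ℝ := (d:ℝ) + 1 with hD
  obtain ⟨t, ht0, ht1, hτ, hcase⟩ := clamp (∑ v, c v) ((2 * H : ℕ) : ℝ) (D ^ 2 - D) (by nlinarith)
  obtain ⟨e, he, hes, hek⟩ := shift c hc _ (fun k => sum_toVec k _ hN2) hN2 t ht0 ht1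
  obtain ⟨U, hU, hUk⟩ := rounding e he
  rw [← hes] at hcase
  generalize t * (((2 * H : ℕ) : ℝ) - ∑ v, c v) = τ at *
  have hkI : ∀ i ∈ I, |(b i - dg U i : ℝ) - (D ^ 2 - τ)| ≤ D := by
    intro i hi
    have := hUk i
    rw [hek, hp', if_pos hi] at this
    rw [abs_le] at this ⊢
    constructor <;> linarith
  have hkJ : ∀ j ∈ J, |(dg U j - b j : ℝ) - (D ^ 2 + τ)| ≤ D := by
    intro j hj
    have := hUk j
    rw [hek, hp', if_neg (Finset.disjoint_right.1 hdisj hj)] at this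
    rw [abs_le] at this ⊢
    constructor <;> linarith
  rw [abs_le] at hτ
  have hUI : ∀ i ∈ I, dg U i ≤ b i := by
    intro i hi
    have := abs_le.1 (hkI i hi)
    have h : (dg U i : ℝ) ≤ b i := by linarith
    exact_mod_cast h
  have hUJ : ∀ j ∈ J, b j ≤ dg U j := by
    intro j hj
    have := abs_le.1 (hkJ j hj)
    have h : (b j : ℝ) ≤ dg U j := by linarith
    exact_mod_cast h
  have hdI : (1:ℝ) ≤ I.card := by exact_mod_cast (by omega : 1 ≤ I.card)
  have hdJ : (1:ℝ) ≤ J.card := by exact_mod_cast hJ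
  have hIJR : (I.card : ℝ) + J.card = d := by exact_mod_cast hIJ
  have sIu : ((∑ i ∈ I, (b i - dg U i) : ℤ) : ℝ) ≤ I.card * (D ^ 2 - τ + D) := by
    push_cast
    rw [← nsmul_eq_mul]
    exact Finset.sum_le_card_nsmul _ _ _ (fun i hi => by have := abs_le.1 (hkI i hi); linarith)
  have sIl : I.card * (D ^ 2 - τ - D) ≤ ((∑ i ∈ I, (b i - dg U i) : ℤ) : ℝ) := by
    push_cast
    rw [← nsmul_eq_mul]
    exact Finset.card_nsmul_le_sum _ _ _ (fun i hi => by have := abs_le.1 (hkI i hi); linarith)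
  have sJu : ((∑ j ∈ J, (dg U j - b j) : ℤ) : ℝ) ≤ J.card * (D ^ 2 + τ + D) := by
    push_cast
    rw [← nsmul_eq_mul]
    exact Finset.sum_le_card_nsmul _ _ _ (fun i hi => by have := abs_le.1 (hkJ i hi); linarith)
  have sJl : J.card * (D ^ 2 + τ - D) ≤ ((∑ j ∈ J, (dg U j - b j) : ℤ) : ℝ) := by
    push_cast
    rw [← nsmul_eq_mul]
    exact Finset.card_nsmul_le_sum _ _ _ (fun i hi => by have := abs_le.1 (hkJ i hi); linarith)
  have main : ∃ U' : Finset (Fin d → Bool), ∀ k, dg U' k = b k := by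
    have n0 : 0 ≤ ∑ i ∈ I, (b i - dg U i) + ∑ j ∈ J, (dg U j - b j) :=
      add_nonneg (Finset.sum_nonneg (fun i hi => sub_nonneg.2 (hUI i hi)))
        (Finset.sum_nonneg (fun i hi => sub_nonneg.2 (hUJ i hi)))
    have hIH : ∀ i ∈ I, b i ≤ (H : ℤ) := fun i hi => by simpa [hH] using hI i hi
    have hJH : ∀ j ∈ J, (H : ℤ) < b j := fun j hj => by simpa [hH] using hJub j hj
    have hD1 : (d : ℝ) = D - 1 := by rw [hD]; ring
    have goal2 : (∑ i ∈ I, (b i - dg U i) ≤ ∑ j ∈ J, (dg U j - b j) ∨ 2 * (H:ℤ) ≤ U.card) ∧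
        (∑ j ∈ J, (dg U j - b j) ≤ ∑ i ∈ I, (b i - dg U i) ∨ (U.card : ℤ) ≤ 2 * (H:ℤ)) := by
      rcases hcase with h | ⟨h, h'⟩ | ⟨h, h'⟩
      · rw [h, Nat.floor_natCast] at hU
        exact ⟨Or.inr (by omega), Or.inr (by omega)⟩
      · have : U.card ≤ 2 * H := by rw [hU]; exact Nat.floor_le_of_le h'
        refine ⟨Or.inl ?_, Or.inr (by omega)⟩
        have : ((∑ i ∈ I, (b i - dg U i) : ℤ) : ℝ) ≤ ((∑ j ∈ J, (dg U j - b j) : ℤ) : ℝ) := by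
          rw [h] at sIu sJl
          nlinarith
        exact_mod_cast this
      · have : 2 * H ≤ U.card := by rw [hU]; exact Nat.le_floor h'
        refine ⟨Or.inr (by omega), Or.inl ?_⟩
        have : ((∑ j ∈ J, (dg U j - b j) : ℤ) : ℝ) ≤ ((∑ i ∈ I, (b i - dg U i) : ℤ) : ℝ) := by
          rw [h] at sIl sJu
          nlinarith
        exact_mod_cast this
    exact finish b I J H hdisj hunion hIH hJH _ U (Int.toNat_of_nonneg n0).symm hUI hUJ
      goal2.1 goal2.2
  obtain ⟨U', hU'⟩ := main
  refine ⟨U', ?_⟩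
  ext k
  rw [← hU' k]
  simp [dg, toVec, Finset.sum_apply]
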